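/- Let H : ℝⁿ ⇉ ℝⁿ be a convex process such that dom(H) + R₋ = ℝⁿ. Then H is reachable if and only if R₊ = ℝⁿ and the negative dual process H⁻ has no nonnegative eigenvalues. -/

import Mathlib

open Pointwise Set RealInnerProductSpace

namespace ConvexProcessPaper

/-- A convex cone: a nonempty convex set closed under nonnegative scalar multiplication. -/
def IsConvexCone {V : Type*} [AddCommMonoid V] [Module ℝ V] (S : Set V) : Prop :=
  S.Nonempty ∧ Convex ℝ S ∧ ∀ c : ℝ, 0 ≤ c → ∀ x ∈ S, c • x ∈ S

/-- A set is a linear subspace. -/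
def IsLinearSubspace {V : Type*} [AddCommGroup V] [Module ℝ V] (S : Set V) : Prop :=
  ∃ W : Submodule ℝ V, (W : Set V) = S

/-- Set-valued maps from ℝⁿ to ℝⁿ. -/
abbrev SVMap (n : ℕ) := EuclideanSpace ℝ (Fin n) → Set (EuclideanSpace ℝ (Fin n))

variable {n : ℕ}

/-- The graph of a set-valued map. -/
def graph (H : SVMap n) : Set (EuclideanSpace ℝ (Fin n) × EuclideanSpace ℝ (Fin n)) :=
  {p | p.2 ∈ H p.1}

/-- A convex process: a set-valued map whose graph is a convex cone. -/
def IsConvexProcess (H : SVMap n) : Prop := IsConvexCone (graph H)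

/-- The domain of a set-valued map. -/
def dom (H : SVMap n) : Set (EuclideanSpace ℝ (Fin n)) := {x | (H x).Nonempty}

/-- The image of a set-valued map. -/
def im (H : SVMap n) : Set (EuclideanSpace ℝ (Fin n)) := {y | ∃ x, y ∈ H x}

/-- The inverse of a set-valued map: gr(H⁻¹) = {(y,x) : (x,y) ∈ gr(H)}. -/
def invMap (H : SVMap n) : SVMap n := fun y => {x | y ∈ H x}

/-- The image of a set under a set-valued map: H(S) = ⋃_{x ∈ S} H(x). -/
def imSet (H : SVMap n) (S : Set (EuclideanSpace ℝ (Fin n))) :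
    Set (EuclideanSpace ℝ (Fin n)) := ⋃ x ∈ S, H x

/-- The reachable set: R(H) = ⋃_{ℓ ≥ 0} H^ℓ({0}). -/
def reach (H : SVMap n) : Set (EuclideanSpace ℝ (Fin n)) := ⋃ ℓ : ℕ, (imSet H)^[ℓ] {0}

/-- The null-controllable set: N(H) = R(H⁻¹). -/
def nullc (H : SVMap n) : Set (EuclideanSpace ℝ (Fin n)) := reach (invMap H)

/-- The feasible set: states from which an infinite trajectory emanates. -/
def feas (H : SVMap n) : Set (EuclideanSpace ℝ (Fin n)) :=
  {ξ | ∃ x : ℕ → EuclideanSpace ℝ (Fin n), x 0 = ξ ∧ ∀ k, x (k + 1) ∈ H (x k)}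

/-- The minimal linear process L₋: gr(L₋) = lin(gr(H)) = gr(H) ∩ (−gr(H)). -/
def Lminus (H : SVMap n) : SVMap n := fun x => {y | y ∈ H x ∧ -y ∈ H (-x)}

/-- The maximal linear process L₊: gr(L₊) = Lin(gr(H)) = gr(H) − gr(H). -/
def Lplus (H : SVMap n) : SVMap n :=
  fun x => {y | ∃ x₁ y₁ x₂ y₂, y₁ ∈ H x₁ ∧ y₂ ∈ H x₂ ∧ x = x₁ - x₂ ∧ y = y₁ - y₂}

/-- The negative dual process: p ∈ H⁻(q) ⇔ ⟨p,x⟩ ≥ ⟨q,y⟩ for all (x,y) ∈ gr(H). -/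
def negDual (H : SVMap n) : SVMap n :=
  fun q => {p | ∀ x y, y ∈ H x → ⟪q, y⟫ ≤ ⟪p, x⟫}

/-- The positive dual process: p ∈ H⁺(q) ⇔ ⟨p,x⟩ ≤ ⟨q,y⟩ for all (x,y) ∈ gr(H). -/
def posDual (H : SVMap n) : SVMap n :=
  fun q => {p | ∀ x y, y ∈ H x → ⟪p, x⟫ ≤ ⟪q, y⟫}

/-- The negative polar cone of a set. -/
def negPolar (C : Set (EuclideanSpace ℝ (Fin n))) : Set (EuclideanSpace ℝ (Fin n)) :=
  {y | ∀ x ∈ C, ⟪x, y⟫ ≤ 0}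

/-- The positive polar cone of a set. -/
def posPolar (C : Set (EuclideanSpace ℝ (Fin n))) : Set (EuclideanSpace ℝ (Fin n)) :=
  {y | ∀ x ∈ C, 0 ≤ ⟪x, y⟫}

/-- C is weakly H invariant: H(x) ∩ C ≠ ∅ for all x ∈ C. -/
def WeaklyInv (H : SVMap n) (C : Set (EuclideanSpace ℝ (Fin n))) : Prop :=
  ∀ x ∈ C, (H x ∩ C).Nonempty

/-- C is strongly H invariant: H(x) ⊆ C for all x ∈ C. -/
def StronglyInv (H : SVMap n) (C : Set (EuclideanSpace ℝ (Fin n))) : Prop :=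
  ∀ x ∈ C, H x ⊆ C

/-- H is reachable: every feasible state is reachable. -/
def IsReachable (H : SVMap n) : Prop := feas H ⊆ reach H

/-- H is null-controllable: every feasible state is null-controllable. -/
def IsNullControllable (H : SVMap n) : Prop := feas H ⊆ nullc H

section ConvexCone

variable {E : Type*} [NormedAddCommGroup E] [InnerProductSpace ℝ E]

theorem smul_mem_interior {C : ConvexCone ℝ E} {c : ℝ} (hc : 0 < c) {x : E}
    (hx : x ∈ interior (C : Set E)) : c • x ∈ interior (C : Set E) := by
  have hsub : c • (C : Set E) ⊆ C := by
    rintro _ ⟨y, hy, rfl⟩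
    exact C.smul_mem hc hy
  apply interior_mono hsub
  rw [interior_smul₀ hc.ne']
  exact smul_mem_smul_set hx

theorem add_mem_interior {C : ConvexCone ℝ E} {x y : E}
    (hx : x ∈ interior (C : Set E)) (hy : y ∈ closure (C : Set E)) :
    x + y ∈ interior (C : Set E) := by
  have h := C.convex.combo_interior_closure_mem_interior hx hy
    (a := 1 / 2) (b := 1 / 2) (by norm_num) (by norm_num) (by norm_num)
  have h2 := smul_mem_interior (c := 2) (by norm_num) h
  convert h2 using 1
  rw [smul_add, smul_smul, smul_smul]
  norm_num

theorem exists_sub_smul_mem_interior {C : ConvexCone ℝ E} {x : E}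
    (hx : x ∈ interior (C : Set E)) (z : E) :
    ∃ t : ℝ, 0 < t ∧ x - t • z ∈ interior (C : Set E) := by
  have hcont : Continuous fun t : ℝ => x - t • z := by fun_prop
  have hmem : (fun t : ℝ => x - t • z) ⁻¹' interior (C : Set E) ∈ nhds (0 : ℝ) :=
    (isOpen_interior.preimage hcont).mem_nhds (by simpa using hx)
  obtain ⟨ε, hε, hball⟩ := Metric.mem_nhds_iff.1 hmem
  refine ⟨ε / 2, by positivity, hball ?_⟩
  rw [Metric.mem_ball, Real.dist_eq, sub_zero, abs_of_pos (by positivity)]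
  linarith

theorem eq_univ_of_zero_mem_interior {C : ConvexCone ℝ E}
    (h : (0 : E) ∈ interior (C : Set E)) : (C : Set E) = univ := by
  refine eq_univ_of_forall fun z => ?_
  obtain ⟨t, ht, hz⟩ := exists_sub_smul_mem_interior h (-z)
  have h1 := C.smul_mem (inv_pos.2 ht) (interior_subset hz)
  simpa [smul_smul, ht.ne'] using h1

theorem interior_nonempty_of_span_eq_top [FiniteDimensional ℝ E] {C : ConvexCone ℝ E}
    (h0 : (0 : E) ∈ C) (hspan : Submodule.span ℝ (C : Set E) = ⊤) :
    (interior (C : Set E)).Nonempty := by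
  rw [C.convex.interior_nonempty_iff_affineSpan_eq_top]
  have h := affineSpan_insert_zero (k := ℝ) (C : Set E)
  rw [insert_eq_of_mem (show (0 : E) ∈ (C : Set E) from h0), hspan] at h
  exact SetLike.coe_injective (by simpa using h)

/-- A proper convex cone of a finite-dimensional space has a nonzero outer normal at the origin. -/
theorem exists_inner_nonpos_of_ne_univ [FiniteDimensional ℝ E] {C : ConvexCone ℝ E}
    (h0 : (0 : E) ∈ C) (hne : (C : Set E) ≠ univ) :
    ∃ ξ : E, ξ ≠ 0 ∧ ∀ x ∈ C, ⟪ξ, x⟫ ≤ 0 := by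
  by_cases hspan : Submodule.span ℝ (C : Set E) = ⊤
  · obtain ⟨e, he⟩ := interior_nonempty_of_span_eq_top h0 hspan
    have hzero : (0 : E) ∉ interior (C : Set E) := fun h => hne (eq_univ_of_zero_mem_interior h)
    obtain ⟨f, hf⟩ := geometric_hahn_banach_open_point C.convex.interior isOpen_interior hzero
    simp only [map_zero] at hf
    refine ⟨(InnerProductSpace.toDual ℝ E).symm f, ?_, fun x hx => ?_⟩
    · intro h
      have hfe := hf e he
      rw [← InnerProductSpace.toDual_symm_apply, h, inner_zero_left] at hfe
      exact lt_irrefl _ hfe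
    · rw [InnerProductSpace.toDual_symm_apply]
      by_contra! hpos
      have hfe := hf e he
      have hs : 0 < -f e / f x := div_pos (by linarith) hpos
      have h := hf _ (add_mem_interior he (subset_closure (C.smul_mem hs hx)))
      rw [map_add, map_smul, smul_eq_mul, div_mul_cancel₀ _ hpos.ne'] at h
      linarith
  · have hbot : (Submodule.span ℝ (C : Set E))ᗮ ≠ ⊥ := fun h =>
      hspan (Submodule.orthogonal_eq_bot_iff.1 h)
    obtain ⟨ξ, hξ, hξ0⟩ := Submodule.exists_mem_ne_zero_of_ne_bot hbot
    exact ⟨ξ, hξ0, fun x hx =>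
      (Submodule.inner_left_of_mem_orthogonal (Submodule.subset_span hx) hξ).le⟩

end ConvexCone

namespace IsConvexProcess

variable {H : SVMap n}

theorem smul_mem (hH : IsConvexProcess H) {c : ℝ} (hc : 0 ≤ c)
    {x y : EuclideanSpace ℝ (Fin n)} (h : y ∈ H x) : c • y ∈ H (c • x) :=
  hH.2.2 c hc (x, y) h

theorem add_mem (hH : IsConvexProcess H) {x y x' y' : EuclideanSpace ℝ (Fin n)}
    (h : y ∈ H x) (h' : y' ∈ H x') : y + y' ∈ H (x + x') := by
  have hconv : Convex ℝ (graph H) := hH.2.1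
  have hmid := hconv (show (x, y) ∈ graph H from h) (show (x', y') ∈ graph H from h')
    (by norm_num : (0 : ℝ) ≤ 1 / 2) (by norm_num : (0 : ℝ) ≤ 1 / 2) (by norm_num)
  have h2 := hH.smul_mem (c := 2) (by norm_num) hmid
  simpa [smul_add, smul_smul] using h2

theorem zero_mem (hH : IsConvexProcess H) : (0 : EuclideanSpace ℝ (Fin n)) ∈ H 0 := by
  obtain ⟨⟨x, y⟩, hxy⟩ := hH.1
  simpa using hH.smul_mem le_rfl hxy

theorem sum_mem (hH : IsConvexProcess H) {ι : Type*} (s : Finset ι)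
    (x y : ι → EuclideanSpace ℝ (Fin n)) (h : ∀ i ∈ s, y i ∈ H (x i)) :
    ∑ i ∈ s, y i ∈ H (∑ i ∈ s, x i) := by
  classical
  induction s using Finset.induction_on with
  | empty => simpa using hH.zero_mem
  | insert a s ha ih =>
    rw [Finset.sum_insert ha, Finset.sum_insert ha]
    exact hH.add_mem (h a (by simp)) (ih fun i hi => h i (by simp [hi]))

end IsConvexProcess

theorem mem_iterate_succ {H : SVMap n} {ℓ : ℕ} {y : EuclideanSpace ℝ (Fin n)} :
    y ∈ (imSet H)^[ℓ + 1] {0} ↔ ∃ x ∈ (imSet H)^[ℓ] {0}, y ∈ H x := by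
  rw [Function.iterate_succ_apply']
  simp [imSet]

theorem mem_reach {H : SVMap n} {y : EuclideanSpace ℝ (Fin n)} :
    y ∈ reach H ↔ ∃ ℓ : ℕ, y ∈ (imSet H)^[ℓ] {0} := mem_iUnion

theorem reach_map {H : SVMap n} {x y : EuclideanSpace ℝ (Fin n)} (hx : x ∈ reach H)
    (hy : y ∈ H x) : y ∈ reach H := by
  obtain ⟨ℓ, hℓ⟩ := mem_reach.1 hx
  exact mem_reach.2 ⟨ℓ + 1, mem_iterate_succ.2 ⟨x, hℓ, hy⟩⟩

theorem zero_mem_reach (H : SVMap n) : (0 : EuclideanSpace ℝ (Fin n)) ∈ reach H :=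
  mem_reach.2 ⟨0, by simp⟩

/-- The reachable set is contained in every strongly invariant set containing the origin. -/
theorem reach_subset {H : SVMap n} {S : Set (EuclideanSpace ℝ (Fin n))} (h0 : 0 ∈ S)
    (hS : StronglyInv H S) : reach H ⊆ S := by
  intro x hx
  obtain ⟨ℓ, hℓ⟩ := mem_reach.1 hx
  clear hx
  induction ℓ generalizing x with
  | zero => simp_all
  | succ ℓ ih =>
    obtain ⟨u, hu, hxu⟩ := mem_iterate_succ.1 hℓ
    exact hS u (ih hu) hxu

theorem reach_mono {H K : SVMap n} (h : ∀ x, H x ⊆ K x) : reach H ⊆ reach K :=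
  reach_subset (zero_mem_reach K) fun x hx _ hy => reach_map hx (h x hy)

theorem iterate_monotone {H : SVMap n} (hH : IsConvexProcess H) :
    Monotone fun ℓ : ℕ => (imSet H)^[ℓ] {0} := by
  refine monotone_nat_of_le_succ fun ℓ => ?_
  induction ℓ with
  | zero =>
    rintro x rfl
    exact mem_iterate_succ.2 ⟨0, rfl, hH.zero_mem⟩
  | succ ℓ ih =>
    intro x hx
    obtain ⟨u, hu, hxu⟩ := mem_iterate_succ.1 hx
    exact mem_iterate_succ.2 ⟨u, ih hu, hxu⟩

theorem iterate_add_mem {H : SVMap n} (hH : IsConvexProcess H) {ℓ : ℕ}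
    {x y : EuclideanSpace ℝ (Fin n)} (hx : x ∈ (imSet H)^[ℓ] {0})
    (hy : y ∈ (imSet H)^[ℓ] {0}) : x + y ∈ (imSet H)^[ℓ] {0} := by
  induction ℓ generalizing x y with
  | zero => simp_all
  | succ ℓ ih =>
    obtain ⟨u, hu, hxu⟩ := mem_iterate_succ.1 hx
    obtain ⟨v, hv, hyv⟩ := mem_iterate_succ.1 hy
    exact mem_iterate_succ.2 ⟨u + v, ih hu hv, hH.add_mem hxu hyv⟩

theorem iterate_smul_mem {H : SVMap n} (hH : IsConvexProcess H) {ℓ : ℕ} {c : ℝ} (hc : 0 ≤ c)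
    {x : EuclideanSpace ℝ (Fin n)} (hx : x ∈ (imSet H)^[ℓ] {0}) :
    c • x ∈ (imSet H)^[ℓ] {0} := by
  induction ℓ generalizing x with
  | zero => simp_all
  | succ ℓ ih =>
    obtain ⟨u, hu, hxu⟩ := mem_iterate_succ.1 hx
    exact mem_iterate_succ.2 ⟨c • u, ih hu, hH.smul_mem hc hxu⟩

/-- The reachable set of a convex process, as a convex cone. -/
def reachCone {H : SVMap n} (hH : IsConvexProcess H) :
    ConvexCone ℝ (EuclideanSpace ℝ (Fin n)) where
  carrier := reach H
  smul_mem' c hc x hx := by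
    obtain ⟨ℓ, hℓ⟩ := mem_reach.1 hx
    exact mem_reach.2 ⟨ℓ, iterate_smul_mem hH hc.le hℓ⟩
  add_mem' x hx y hy := by
    obtain ⟨i, hi⟩ := mem_reach.1 hx
    obtain ⟨j, hj⟩ := mem_reach.1 hy
    exact mem_reach.2 ⟨max i j, iterate_add_mem hH
      (iterate_monotone hH (le_max_left i j) hi) (iterate_monotone hH (le_max_right i j) hj)⟩

theorem isConvexProcess_Lminus {H : SVMap n} (hH : IsConvexProcess H) :
    IsConvexProcess (Lminus H) := by
  refine ⟨⟨0, ?_⟩, ?_, ?_⟩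
  · exact ⟨hH.zero_mem, by simpa using hH.zero_mem⟩
  · rintro ⟨x, y⟩ ⟨h1, h2⟩ ⟨x', y'⟩ ⟨h1', h2'⟩ a b ha hb -
    refine ⟨hH.add_mem (hH.smul_mem ha h1) (hH.smul_mem hb h1'), ?_⟩
    have h := hH.add_mem (hH.smul_mem ha h2) (hH.smul_mem hb h2')
    simpa [add_comm] using h
  · rintro c hc ⟨x, y⟩ ⟨h1, h2⟩
    refine ⟨hH.smul_mem hc h1, ?_⟩
    simpa using hH.smul_mem hc h2

theorem Lminus_neg {H : SVMap n} {x y : EuclideanSpace ℝ (Fin n)} (h : y ∈ Lminus H x) :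
    -y ∈ Lminus H (-x) := ⟨h.2, by simpa using h.1⟩

theorem iterate_Lminus_neg_mem {H : SVMap n} {ℓ : ℕ} {x : EuclideanSpace ℝ (Fin n)}
    (hx : x ∈ (imSet (Lminus H))^[ℓ] {0}) : -x ∈ (imSet (Lminus H))^[ℓ] {0} := by
  induction ℓ generalizing x with
  | zero => simp_all
  | succ ℓ ih =>
    obtain ⟨u, hu, hxu⟩ := mem_iterate_succ.1 hx
    exact mem_iterate_succ.2 ⟨-u, ih hu, Lminus_neg hxu⟩

theorem neg_mem_reach_Lminus {H : SVMap n} {x : EuclideanSpace ℝ (Fin n)}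
    (hx : x ∈ reach (Lminus H)) : -x ∈ reach (Lminus H) := by
  obtain ⟨ℓ, hℓ⟩ := mem_reach.1 hx
  exact mem_reach.2 ⟨ℓ, iterate_Lminus_neg_mem hℓ⟩

theorem reach_Lminus_subset (H : SVMap n) : reach (Lminus H) ⊆ reach H :=
  reach_mono fun _ _ hy => hy.1

/-- The states reachable in `ℓ` steps of the minimal linear process, as a subspace. -/
def iterateSubmodule {H : SVMap n} (hH : IsConvexProcess H) (ℓ : ℕ) :
    Submodule ℝ (EuclideanSpace ℝ (Fin n)) where
  carrier := (imSet (Lminus H))^[ℓ] {0}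
  zero_mem' := iterate_monotone (isConvexProcess_Lminus hH) (Nat.zero_le ℓ) rfl
  add_mem' := iterate_add_mem (isConvexProcess_Lminus hH)
  smul_mem' c x hx := by
    rcases le_total 0 c with hc | hc
    · exact iterate_smul_mem (isConvexProcess_Lminus hH) hc hx
    · simpa using iterate_Lminus_neg_mem
        (iterate_smul_mem (isConvexProcess_Lminus hH) (neg_nonneg.2 hc) hx)

theorem exists_reach_Lminus_eq_iterate {H : SVMap n} (hH : IsConvexProcess H) :
    ∃ ℓ : ℕ, reach (Lminus H) = (imSet (Lminus H))^[ℓ] {0} := by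
  obtain ⟨ℓ, hℓ⟩ := monotone_stabilizes_iff_noetherian.2
    (inferInstance : IsNoetherian ℝ (EuclideanSpace ℝ (Fin n)))
    ⟨iterateSubmodule hH, iterate_monotone (isConvexProcess_Lminus hH)⟩
  refine ⟨ℓ, Subset.antisymm (fun x hx => ?_) fun x hx => mem_reach.2 ⟨ℓ, hx⟩⟩
  obtain ⟨m, hm⟩ := mem_reach.1 hx
  have h : x ∈ iterateSubmodule hH (max ℓ m) :=
    iterate_monotone (isConvexProcess_Lminus hH) (le_max_right ℓ m) hm
  have heq : iterateSubmodule hH ℓ = iterateSubmodule hH (max ℓ m) := hℓ _ (le_max_left _ _)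
  rwa [← heq] at h

/-- A state reachable in `ℓ` steps is the end of a trajectory, indexed backwards in time, that
vanishes `ℓ` or more steps earlier. -/
theorem exists_backward_trajectory {H : SVMap n} (hH : IsConvexProcess H) {ℓ : ℕ}
    {x : EuclideanSpace ℝ (Fin n)} (hx : x ∈ (imSet H)^[ℓ] {0}) :
    ∃ b : ℕ → EuclideanSpace ℝ (Fin n), b 0 = x ∧ (∀ m, b m ∈ H (b (m + 1))) ∧
      (∀ m, b m ∈ reach H) ∧ ∀ m, ℓ ≤ m → b m = 0 := by
  induction ℓ generalizing x with
  | zero =>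
    have hx0 : x = 0 := hx
    exact ⟨fun _ => 0, hx0.symm, fun _ => hH.zero_mem, fun _ => zero_mem_reach H, fun _ _ => rfl⟩
  | succ ℓ ih =>
    obtain ⟨u, hu, hxu⟩ := mem_iterate_succ.1 hx
    obtain ⟨b, hb0, hb, hbR, hbℓ⟩ := ih hu
    refine ⟨fun m => m.casesOn x b, rfl, ?_, ?_, ?_⟩
    · rintro (_ | m)
      · simpa [hb0] using hxu
      · exact hb m
    · rintro (_ | m)
      · exact mem_reach.2 ⟨_, hx⟩
      · exact hbR m
    · rintro (_ | m) hm
      · omega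
      · exact hbℓ m (by omega)

theorem exists_dom_add_reach_Lminus {H : SVMap n} (hdom : dom H + reach (Lminus H) = univ)
    (x : EuclideanSpace ℝ (Fin n)) :
    ∃ d r, d ∈ dom H ∧ r ∈ reach (Lminus H) ∧ d + r = x := by
  have hx : x ∈ dom H + reach (Lminus H) := hdom ▸ mem_univ x
  obtain ⟨d, hd, r, hr, h⟩ := hx
  exact ⟨d, r, hd, hr, h⟩

/-- Corrections by trajectories of the minimal linear process make every state feasible. -/
theorem feas_add_reach_Lminus {H : SVMap n} (hH : IsConvexProcess H)
    (hdom : dom H + reach (Lminus H) = univ) : feas H + reach (Lminus H) = univ := by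
  have hL := isConvexProcess_Lminus hH
  have hdec := exists_dom_add_reach_Lminus hdom
  obtain ⟨ℓ, hℓ⟩ := exists_reach_Lminus_eq_iterate hH
  have hstep : ∀ d : dom H, ∃ d' : dom H, ∃ r ∈ reach (Lminus H),
      (d' : EuclideanSpace ℝ (Fin n)) + r ∈ H d := by
    rintro ⟨d, y, hy⟩
    obtain ⟨d', r, hd', hr, rfl⟩ := hdec y
    exact ⟨⟨d', hd'⟩, r, hr, hy⟩
  choose next r hr hnext using hstep
  refine eq_univ_of_forall fun x => ?_
  obtain ⟨d₀, r₀, hd₀, hr₀, rfl⟩ := hdec x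
  let d : ℕ → dom H := fun k => next^[k] ⟨d₀, hd₀⟩
  have hd : ∀ k, d (k + 1) = next (d k) := fun k => Function.iterate_succ_apply' _ _ _
  choose b hb0 hb hbR hbℓ using fun k =>
    exists_backward_trajectory hL (hℓ ▸ hr (d k) : r (d k) ∈ (imSet (Lminus H))^[ℓ] {0})
  let corr : ℕ → EuclideanSpace ℝ (Fin n) := fun j =>
    ∑ m ∈ Finset.range ℓ, b (j + m) (m + 1)
  have hcorr : ∀ j, r (d j) + corr (j + 1) ∈ Lminus H (corr j) := fun j => by
    have hsum : r (d j) + corr (j + 1) = ∑ m ∈ Finset.range ℓ, b (j + m) m := by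
      have h1 := Finset.sum_range_succ (fun m => b (j + m) m) ℓ
      have h2 := Finset.sum_range_succ' (fun m => b (j + m) m) ℓ
      rw [hbℓ (j + ℓ) ℓ le_rfl, add_zero] at h1
      rw [← h1, h2, add_zero, hb0, add_comm]
      congr 1
      exact Finset.sum_congr rfl fun m _ => by rw [add_assoc, add_comm 1 m]
    rw [hsum]
    exact hL.sum_mem _ _ _ fun m _ => hb (j + m) m
  have hcorr0 : corr 0 ∈ reach (Lminus H) :=
    Finset.sum_induction _ (· ∈ reach (Lminus H)) (fun _ _ h h' => (reachCone hL).add_mem h h')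
      (zero_mem_reach _) fun m _ => hbR (0 + m) (m + 1)
  refine ⟨d₀ - corr 0, ⟨fun j => d j - corr j, rfl, fun j => ?_⟩, corr 0 + r₀,
    (reachCone hL).add_mem hcorr0 hr₀, ?_⟩
  swap
  · change d₀ - corr 0 + (corr 0 + r₀) = d₀ + r₀
    abel
  have h := hH.add_mem (hnext (d j)) (hcorr j).2
  rw [← hd] at h
  convert h using 1
  · exact congrArg H (sub_eq_add_neg _ _)
  · change (d (j + 1) : EuclideanSpace ℝ (Fin n)) - corr (j + 1) = _
    abel

/-- The reachable set spans the reachable set of the maximal linear process. -/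
theorem reach_Lplus_subset_span {H : SVMap n} (hH : IsConvexProcess H)
    (hdom : dom H + reach (Lminus H) = univ) :
    reach (Lplus H) ⊆ Submodule.span ℝ (reach H) := by
  have hdec := exists_dom_add_reach_Lminus hdom
  have hsub := reach_Lminus_subset H
  have hspan : ∀ x ∈ Submodule.span ℝ (reach H), ∃ u ∈ reach H, ∃ v ∈ reach H, x = u - v := by
    intro x hx
    induction hx using Submodule.span_induction with
    | mem x hx => exact ⟨x, hx, 0, zero_mem_reach H, by simp⟩
    | zero => exact ⟨0, zero_mem_reach H, 0, zero_mem_reach H, by simp⟩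
    | add x y _ _ hx hy =>
      obtain ⟨u, hu, v, hv, rfl⟩ := hx
      obtain ⟨u', hu', v', hv', rfl⟩ := hy
      exact ⟨u + u', (reachCone hH).add_mem hu hu', v + v', (reachCone hH).add_mem hv hv',
        by abel⟩
    | smul c x _ hx =>
      obtain ⟨u, hu, v, hv, rfl⟩ := hx
      rcases lt_trichotomy c 0 with hc | rfl | hc
      · exact ⟨-c • v, (reachCone hH).smul_mem (neg_pos.2 hc) hv,
          -c • u, (reachCone hH).smul_mem (neg_pos.2 hc) hu, by module⟩
      · exact ⟨0, zero_mem_reach H, 0, zero_mem_reach H, by simp⟩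
      · exact ⟨c • u, (reachCone hH).smul_mem hc hu, c • v, (reachCone hH).smul_mem hc hv,
          by module⟩
  refine reach_subset (Submodule.zero_mem _) ?_
  rintro x hx y ⟨x₁, y₁, x₂, y₂, h₁, h₂, rfl, rfl⟩
  obtain ⟨u, hu, v, hv, huv⟩ := hspan _ hx
  obtain ⟨d, s, ⟨e, he⟩, hs, rfl⟩ := hdec v
  obtain ⟨d', s', ⟨z, hz⟩, hs', hds'⟩ := hdec (-x₂)
  have hd : d ∈ reach H := by
    have h : d + s + -s ∈ reach H := (reachCone hH).add_mem hv (hsub (neg_mem_reach_Lminus hs))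
    rwa [add_neg_cancel_right] at h
  have hsum : x₁ + d + d' = u + (-s + -s') := by
    rw [eq_sub_of_add_eq hds', eq_add_of_sub_eq huv]
    abel
  have hA : y₁ + e + z ∈ reach H := by
    have h := hH.add_mem (hH.add_mem h₁ he) hz
    rw [hsum] at h
    exact reach_map ((reachCone hH).add_mem hu ((reachCone hH).add_mem
      (hsub (neg_mem_reach_Lminus hs)) (hsub (neg_mem_reach_Lminus hs')))) h
  have hB : y₂ + z ∈ reach H := by
    have h := hH.add_mem h₂ hz
    rw [show x₂ + d' = -s' by rw [eq_sub_of_add_eq hds']; abel] at h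
    exact reach_map (hsub (neg_mem_reach_Lminus hs')) h
  have hE : e ∈ reach H := reach_map hd he
  have hy : y₁ - y₂ = (y₁ + e + z) - e - (y₂ + z) := by abel
  rw [hy]
  exact Submodule.sub_mem _ (Submodule.sub_mem _ (Submodule.subset_span hA)
    (Submodule.subset_span hE)) (Submodule.subset_span hB)

/-- If `H - λ` is not onto, then `λ` is an eigenvalue of the negative dual process. -/
theorem exists_eigenvector_of_not_surjective {H : SVMap n} (hH : IsConvexProcess H) {lam : ℝ}
    (h : ¬ ∀ z, ∃ x y, y ∈ H x ∧ y - lam • x = z) :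
    ∃ ξ : EuclideanSpace ℝ (Fin n), ξ ≠ 0 ∧ lam • ξ ∈ negDual H ξ := by
  let C : ConvexCone ℝ (EuclideanSpace ℝ (Fin n)) :=
    { carrier := {z | ∃ x y, y ∈ H x ∧ y - lam • x = z}
      smul_mem' := by
        rintro c hc _ ⟨x, y, hxy, rfl⟩
        exact ⟨c • x, c • y, hH.smul_mem hc.le hxy, by module⟩
      add_mem' := by
        rintro _ ⟨x, y, hxy, rfl⟩ _ ⟨x', y', hxy', rfl⟩
        exact ⟨x + x', y + y', hH.add_mem hxy hxy', by module⟩ }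
  have h0 : (0 : EuclideanSpace ℝ (Fin n)) ∈ C := ⟨0, 0, hH.zero_mem, by simp⟩
  obtain ⟨ξ, hξ, hC⟩ := exists_inner_nonpos_of_ne_univ h0 fun hC =>
    h fun z => (hC ▸ mem_univ z : z ∈ (C : Set _))
  refine ⟨ξ, hξ, fun x y hxy => ?_⟩
  have hle := hC _ ⟨x, y, hxy, rfl⟩
  rw [inner_sub_right, inner_smul_right] at hle
  rw [real_inner_smul_left]
  linarith

/-- The points `w` for which `lam • w - r'` is a successor of `w + r` for some `r`, `r'` in the
interior of the reachable set. -/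
def strictPoints (H : SVMap n) (lam : ℝ) : Set (EuclideanSpace ℝ (Fin n)) :=
  {w | ∃ r ∈ interior (reach H), ∃ r' ∈ interior (reach H), lam • w - r' ∈ H (w + r)}

section StrictPoints

variable {H : SVMap n}

theorem convex_strictPoints (hH : IsConvexProcess H) (lam : ℝ) :
    Convex ℝ (strictPoints H lam) := by
  have hI : Convex ℝ (interior (reach H)) := (reachCone hH).convex.interior
  rintro w ⟨r, hr, r', hr', h⟩ v ⟨s, hs, s', hs', h'⟩ a b ha hb hab
  refine ⟨_, hI hr hs ha hb hab, _, hI hr' hs' ha hb hab, ?_⟩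
  convert hH.add_mem (hH.smul_mem ha h) (hH.smul_mem hb h') using 1
  · congr 1
    module
  · module

theorem strictPoints_nonempty (hne : (interior (reach H)).Nonempty) {lam : ℝ}
    (hsurj : ∀ z, ∃ x y, y ∈ H x ∧ y - lam • x = z) : (strictPoints H lam).Nonempty := by
  obtain ⟨e, he⟩ := hne
  obtain ⟨x, y, hxy, hz⟩ := hsurj (-e - lam • e)
  refine ⟨x - e, e, he, e, he, ?_⟩
  rw [sub_add_cancel]
  convert hxy using 1
  rw [eq_add_of_sub_eq hz]
  module

theorem mem_interior_of_mem_closure_of_strict (hH : IsConvexProcess H) {lam : ℝ}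
    (hlam : 0 < lam) {w : EuclideanSpace ℝ (Fin n)} (hw : w ∈ strictPoints H lam)
    (hcl : w ∈ closure (reach H)) : w ∈ interior (reach H) := by
  obtain ⟨r, hr, r', hr', h⟩ := hw
  have hwr : w + r ∈ reach H := by
    rw [add_comm]
    exact interior_subset (add_mem_interior (C := reachCone hH) hr hcl)
  have hmem := add_mem_interior (C := reachCone hH) hr' (subset_closure (reach_map hwr h))
  rw [add_sub_cancel] at hmem
  have hscale := smul_mem_interior (C := reachCone hH) (inv_pos.2 hlam) hmem
  rwa [inv_smul_smul₀ hlam.ne'] at hscale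

/-- Strict points cannot leave the interior of the reachable set through its boundary. -/
theorem strictPoints_subset_interior (hH : IsConvexProcess H) {lam : ℝ} (hlam : 0 < lam)
    (hne : (strictPoints H lam ∩ interior (reach H)).Nonempty) :
    strictPoints H lam ⊆ interior (reach H) :=
  (convex_strictPoints hH lam).isPreconnected.subset_of_closure_inter_subset isOpen_interior hne
    fun _ ⟨hcl, hw⟩ => mem_interior_of_mem_closure_of_strict hH hlam hw
      (closure_mono interior_subset hcl)

theorem strictPoints_inter_mono (hH : IsConvexProcess H) {lam mu : ℝ} (hle : lam ≤ mu) :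
    strictPoints H lam ∩ interior (reach H) ⊆ strictPoints H mu ∩ interior (reach H) := by
  rintro w ⟨⟨r, hr, r', hr', h⟩, hw⟩
  refine ⟨⟨r, hr, r' + (mu - lam) • w, ?_, ?_⟩, hw⟩
  · rcases hle.eq_or_lt with rfl | hlt
    · simpa using hr'
    · exact add_mem_interior (C := reachCone hH) hr' (subset_closure
        ((reachCone hH).smul_mem (sub_pos.2 hlt) (interior_subset hw)))
  · convert h using 1
    module

theorem mem_strictPoints_of_abs_sub_lt {lam : ℝ} {w : EuclideanSpace ℝ (Fin n)}
    (hw : w ∈ strictPoints H lam) : ∃ ε > 0, ∀ mu, |mu - lam| < ε → w ∈ strictPoints H mu := by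
  obtain ⟨r, hr, r', hr', h⟩ := hw
  have hcont : Continuous fun mu : ℝ => r' + (mu - lam) • w := by fun_prop
  have hmem : (fun mu : ℝ => r' + (mu - lam) • w) ⁻¹' interior (reach H) ∈ nhds lam :=
    (isOpen_interior.preimage hcont).mem_nhds (by simpa using hr')
  obtain ⟨ε, hε, hball⟩ := Metric.mem_nhds_iff.1 hmem
  refine ⟨ε, hε, fun mu hmu => ⟨r, hr, _, hball (show mu ∈ Metric.ball lam ε from hmu), ?_⟩⟩
  convert h using 1
  module

theorem exists_strictPoints_inter_interior (hH : IsConvexProcess H)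
    (hdom : dom H + reach (Lminus H) = univ) (hne : (interior (reach H)).Nonempty) :
    ∃ lam : ℝ, 0 < lam ∧ (strictPoints H lam ∩ interior (reach H)).Nonempty := by
  obtain ⟨e, he⟩ := hne
  have hmem : e + e ∈ dom H + reach (Lminus H) := hdom ▸ mem_univ _
  obtain ⟨d, ⟨y, hy⟩, s, hs, hds⟩ := hmem
  obtain ⟨t, ht, hty⟩ := exists_sub_smul_mem_interior (C := reachCone hH) he y
  refine ⟨t⁻¹, inv_pos.2 ht, e, ⟨e + -s, ?_, t⁻¹ • (e - t • y), ?_, ?_⟩, he⟩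
  · exact add_mem_interior (C := reachCone hH) he
      (subset_closure (reach_Lminus_subset H (neg_mem_reach_Lminus hs)))
  · exact smul_mem_interior (C := reachCone hH) (inv_pos.2 ht) hty
  · convert hy using 1
    · have hd : d = e + e - s := eq_sub_of_add_eq hds
      rw [hd]
      congr 1
      abel
    · rw [smul_sub, inv_smul_smul₀ ht.ne', sub_sub_cancel]

end StrictPoints

/-- If the reachable set has interior points and every `H - λ` with `λ ≥ 0` is onto, then every
state is reachable. -/
theorem reach_eq_univ_of_surjective {H : SVMap n} (hH : IsConvexProcess H)
    (hdom : dom H + reach (Lminus H) = univ) (hne : (interior (reach H)).Nonempty)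
    (hsurj : ∀ lam : ℝ, 0 ≤ lam → ∀ z, ∃ x y, y ∈ H x ∧ y - lam • x = z) :
    reach H = univ := by
  let A : Set ℝ := {lam | 0 ≤ lam ∧ (strictPoints H lam ∩ interior (reach H)).Nonempty}
  have hA : A.Nonempty := by
    obtain ⟨lam, hlam, h⟩ := exists_strictPoints_inter_interior hH hdom hne
    exact ⟨lam, hlam.le, h⟩
  have hbdd : BddBelow A := ⟨0, fun _ h => h.1⟩
  have hinf0 : 0 ≤ sInf A := le_csInf hA fun _ h => h.1
  have hinf : sInf A ∈ A := by
    refine ⟨hinf0, ?_⟩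
    obtain ⟨w, hw⟩ := strictPoints_nonempty hne (hsurj _ hinf0)
    obtain ⟨ε, hε, hint⟩ := mem_strictPoints_of_abs_sub_lt hw
    obtain ⟨lam, hlamA, hlam⟩ := exists_lt_of_csInf_lt hA (show sInf A < sInf A + ε / 2 by linarith)
    have hw' : w ∈ strictPoints H (sInf A + ε / 2) := hint _ (by
      rw [add_sub_cancel_left, abs_of_pos (by linarith)]
      linarith)
    exact ⟨w, hw, strictPoints_subset_interior hH (by linarith)
      (hlamA.2.mono (strictPoints_inter_mono hH hlam.le)) hw'⟩
  obtain ⟨-, w, hw, hwI⟩ := hinf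
  rcases hinf0.eq_or_lt with h0 | hpos
  · rw [← h0] at hw
    obtain ⟨r, hr, r', hr', h⟩ := hw
    have hwr : w + r ∈ reach H := (reachCone hH).add_mem (interior_subset hwI) (interior_subset hr)
    have hz := add_mem_interior (C := reachCone hH) hr' (subset_closure (reach_map hwr h))
    rw [add_sub_cancel, zero_smul] at hz
    exact eq_univ_of_zero_mem_interior hz
  · obtain ⟨ε, hε, hint⟩ := mem_strictPoints_of_abs_sub_lt hw
    have hδ : 0 < min (ε / 2) (sInf A) := lt_min (by linarith) hpos
    have hδε := min_le_left (ε / 2) (sInf A)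
    have hδA := min_le_right (ε / 2) (sInf A)
    have hmem : sInf A - min (ε / 2) (sInf A) ∈ A := by
      refine ⟨by linarith, w, hint _ ?_, hwI⟩
      rw [sub_sub_cancel_left, abs_neg, abs_of_pos hδ]
      linarith
    linarith [csInf_le hbdd hmem]

theorem subset_Lplus {H : SVMap n} (hH : IsConvexProcess H) (x : EuclideanSpace ℝ (Fin n)) :
    H x ⊆ Lplus H x := fun y hy => ⟨x, y, 0, 0, hy, hH.zero_mem, by simp, by simp⟩

theorem inner_nonpos_of_mem_reach {H : SVMap n} {lam : ℝ} (hlam : 0 ≤ lam)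
    {ξ x : EuclideanSpace ℝ (Fin n)} (hξ : lam • ξ ∈ negDual H ξ) (hx : x ∈ reach H) :
    ⟪ξ, x⟫ ≤ 0 := by
  refine reach_subset (S := {x | ⟪ξ, x⟫ ≤ 0}) (by simp) (fun u hu y hy => ?_) hx
  have h := hξ u y hy
  rw [real_inner_smul_left] at h
  exact h.trans (mul_nonpos_of_nonneg_of_nonpos hlam hu)

/-- reachability iff R₊ = ℝⁿ and H⁻ has no nonnegative eigenvalues. -/
theorem reachability_iff {n : ℕ} (H : SVMap n) (hH : IsConvexProcess H)
    (hdom : dom H + reach (Lminus H) = Set.univ) :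
    IsReachable H ↔
      reach (Lplus H) = Set.univ ∧
        ¬ ∃ lam : ℝ, 0 ≤ lam ∧ ∃ ξ : EuclideanSpace ℝ (Fin n), ξ ≠ 0 ∧ lam • ξ ∈ negDual H ξ := by
  constructor
  · intro hreach
    have hR : reach H = Set.univ := by
      refine eq_univ_of_forall fun x => ?_
      have hx : x ∈ feas H + reach (Lminus H) := feas_add_reach_Lminus hH hdom ▸ mem_univ x
      obtain ⟨u, hu, r, hr, rfl⟩ := hx
      exact (reachCone hH).add_mem (hreach hu) (reach_Lminus_subset H hr)
    refine ⟨univ_subset_iff.1 (hR ▸ reach_mono (subset_Lplus hH)), ?_⟩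
    rintro ⟨lam, hlam, ξ, hξ0, hξ⟩
    have h := inner_nonpos_of_mem_reach hlam hξ (hR ▸ mem_univ ξ : ξ ∈ reach H)
    exact hξ0 (inner_self_eq_zero.1 (h.antisymm real_inner_self_nonneg))
  · rintro ⟨hplus, heig⟩
    have hspan : Submodule.span ℝ (reach H) = ⊤ :=
      eq_top_iff.2 fun x _ => reach_Lplus_subset_span hH hdom (hplus ▸ mem_univ x)
    have hne : (interior (reach H)).Nonempty :=
      interior_nonempty_of_span_eq_top (C := reachCone hH) (zero_mem_reach H) hspan
    have hR := reach_eq_univ_of_surjective hH hdom hne fun lam hlam => by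
      by_contra h
      exact heig ⟨lam, hlam, exists_eigenvector_of_not_surjective hH h⟩
    exact fun x _ => hR ▸ mem_univ x

end ConvexProcessPaper
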